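/- arXiv:1801.09046 — 4 statements merged into one kernel-verified Lean document; each statement's English description precedes it below -/
import Mathlib

section
/- Let there be n agents with binary additive valuations over m goods, let A* be a Nash optimal allocation with NSW(A*) > 0, and let A be a non-wasteful allocation with 0 < NSW(A) < NSW(A*). Then there exist agents u ≠ v such that v is reachable from u in the directed graph G(A) (which has an edge from a to b whenever some good j ∈ A_a satisfies v_{b,j} = 1), such that v_u(A_u) ≥ 2, and such that the quantity NSW' defined by (NSW')^n = (∏_{i ≠ u,v} v_i(A_i)) · (v_u(A_u) − 1) · (v_v(A_v) + 1) satisfies ln NSW(A*) − ln NSW' ≤ (1 − 1/m)·(ln NSW(A*) − ln NSW(A)). -/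
open Finset

/-- The Nash social welfare of an allocation `A` under additive valuations `w`:
the geometric mean of the agents' bundle values. -/
noncomputable def NSW {n m : ℕ} (w : Fin n → Fin m → ℝ)
    (A : Fin n → Finset (Fin m)) : ℝ :=
  (∏ i : Fin n, ∑ j ∈ A i, w i j) ^ ((n : ℝ)⁻¹)

/-- Concavity of `log`: gaining `s - a ≥ 1` units at once is worth at most `s - a` times the
first unit. -/
theorem log_sub_log_le_mul_succ {a s : ℝ} (ha : 0 < a) (h : a + 1 ≤ s) :
    Real.log s - Real.log a ≤ (s - a) * (Real.log (a + 1) - Real.log a) := by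
  have hd : 0 < s - a := by linarith
  have hinv : (s - a)⁻¹ ≤ 1 := inv_le_one_of_one_le₀ (by linarith)
  have key := strictConcaveOn_log_Ioi.concaveOn.2 (Set.mem_Ioi.2 ha)
    (Set.mem_Ioi.2 (by linarith : 0 < s)) (sub_nonneg.2 hinv) (inv_nonneg.2 hd.le) (by ring)
  have hpt : (1 - (s - a)⁻¹) * a + (s - a)⁻¹ * s = a + 1 := by
    field_simp
    ring
  simp only [smul_eq_mul] at key
  rw [hpt] at key
  have := mul_le_mul_of_nonneg_left key hd.le
  have h1 : (s - a) * ((1 - (s - a)⁻¹) * Real.log a + (s - a)⁻¹ * Real.log s) =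
      (s - a) * Real.log a - Real.log a + Real.log s := by
    field_simp
  linarith

/-- Concavity of `log`: losing `a - s ≥ 1` units at once costs at least `a - s` times the
first unit. -/
theorem log_sub_log_le_mul_pred {a s : ℝ} (hs : 0 < s) (h : s + 1 ≤ a) :
    Real.log s - Real.log a ≤ (s - a) * (Real.log a - Real.log (a - 1)) := by
  have hd : 0 < a - s := by linarith
  have hinv : (a - s)⁻¹ ≤ 1 := inv_le_one_of_one_le₀ (by linarith)
  have key := strictConcaveOn_log_Ioi.concaveOn.2 (Set.mem_Ioi.2 (by linarith : 0 < a))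
    (Set.mem_Ioi.2 hs) (sub_nonneg.2 hinv) (inv_nonneg.2 hd.le) (by ring)
  have hpt : (1 - (a - s)⁻¹) * a + (a - s)⁻¹ * s = a - 1 := by
    field_simp
    ring
  simp only [smul_eq_mul] at key
  rw [hpt] at key
  have := mul_le_mul_of_nonneg_left key hd.le
  have h1 : (a - s) * ((1 - (a - s)⁻¹) * Real.log a + (a - s)⁻¹ * Real.log s) =
      (a - s) * Real.log a - Real.log a + Real.log s := by
    field_simp
  linarith

/-- Summing bundle by bundle over an allocation is summing over all goods. -/
theorem sum_sum_bundle {n m : ℕ} {B : Fin n → Finset (Fin m)}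
    (hdisj : ∀ k l : Fin n, k ≠ l → Disjoint (B k) (B l))
    (hcov : ∀ j : Fin m, ∃ k : Fin n, j ∈ B k) (q : Fin m → ℝ) :
    ∑ i, ∑ j ∈ B i, q j = ∑ j, q j := by
  rw [← Finset.sum_biUnion (fun k _ l _ hkl => hdisj k l hkl)]
  congr 1
  ext j
  simpa using hcov j

/-- A nonnegative potential that does not increase along the edges of the exchange graph of a
non-wasteful allocation `A` gives every allocation `S` at most as much weighted value as `A`. -/
theorem sum_value_mul_le_of_antitone_potential {n m : ℕ} {w : Fin n → Fin m → ℝ}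
    (hbin : ∀ i j, w i j = 0 ∨ w i j = 1) {A S : Fin n → Finset (Fin m)}
    (hAdisj : ∀ k l : Fin n, k ≠ l → Disjoint (A k) (A l))
    (hAcov : ∀ j : Fin m, ∃ k : Fin n, j ∈ A k)
    (hSdisj : ∀ k l : Fin n, k ≠ l → Disjoint (S k) (S l))
    (hScov : ∀ j : Fin m, ∃ k : Fin n, j ∈ S k)
    (hnw : ∀ i : Fin n, ∀ j ∈ A i, w i j = 1) {p : Fin n → ℝ} (hp : ∀ i, 0 ≤ p i)
    (hedge : ∀ a b, (∃ j ∈ A a, w b j = 1) → p b ≤ p a) :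
    ∑ i, (∑ j ∈ S i, w i j) * p i ≤ ∑ i, (∑ j ∈ A i, w i j) * p i := by
  choose owner howner using hAcov
  have hA : ∑ i, (∑ j ∈ A i, w i j) * p i = ∑ j, p (owner j) := by
    rw [← sum_sum_bundle hAdisj (fun j => ⟨_, howner j⟩)]
    refine Finset.sum_congr rfl fun i _ => ?_
    rw [Finset.sum_mul]
    refine Finset.sum_congr rfl fun j hj => ?_
    have : owner j = i := by
      by_contra hne
      exact Finset.disjoint_left.1 (hAdisj _ _ hne) (howner j) hj
    rw [hnw i j hj, this, one_mul]
  rw [hA, ← sum_sum_bundle hSdisj hScov]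
  refine Finset.sum_le_sum fun i _ => ?_
  rw [Finset.sum_mul]
  refine Finset.sum_le_sum fun j _ => ?_
  rcases hbin i j with h | h
  · simpa [h] using hp (owner j)
  · simpa [h] using hedge (owner j) i ⟨j, howner j, h⟩

theorem prod_pos_of_NSW_pos {n m : ℕ} (hn : 0 < n) {w : Fin n → Fin m → ℝ}
    (hw : ∀ i j, 0 ≤ w i j) {B : Fin n → Finset (Fin m)} (h : 0 < NSW w B) :
    0 < ∏ i : Fin n, ∑ j ∈ B i, w i j := by
  refine lt_of_le_of_ne (Finset.prod_nonneg fun i _ => Finset.sum_nonneg fun j _ => hw i j) ?_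
  intro h0
  have hn' : ((n : ℝ)⁻¹) ≠ 0 := by positivity
  rw [NSW, ← h0, Real.zero_rpow hn'] at h
  exact h.false

theorem value_pos_of_NSW_pos {n m : ℕ} (hn : 0 < n) {w : Fin n → Fin m → ℝ}
    (hw : ∀ i j, 0 ≤ w i j) {B : Fin n → Finset (Fin m)} (h : 0 < NSW w B) (i : Fin n) :
    0 < ∑ j ∈ B i, w i j :=
  lt_of_le_of_ne (Finset.sum_nonneg fun j _ => hw i j)
    (Finset.prod_ne_zero_iff.1 (prod_pos_of_NSW_pos hn hw h).ne' i (Finset.mem_univ i)).symm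

theorem log_NSW_eq {n m : ℕ} (hn : 0 < n) {w : Fin n → Fin m → ℝ}
    (hw : ∀ i j, 0 ≤ w i j) {B : Fin n → Finset (Fin m)} (h : 0 < NSW w B) :
    Real.log (NSW w B) = (n : ℝ)⁻¹ * ∑ i : Fin n, Real.log (∑ j ∈ B i, w i j) := by
  rw [NSW, Real.log_rpow (prod_pos_of_NSW_pos hn hw h),
    Real.log_prod fun i _ => (value_pos_of_NSW_pos hn hw h i).ne']

/-- The logarithm of a product of positive numbers after moving one unit from the factor `u` to
the factor `v`. -/
theorem log_prod_transfer {ι : Type*} [Fintype ι] [DecidableEq ι] {a : ι → ℝ}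
    (ha : ∀ i, 0 < a i) {u v : ι} (huv : u ≠ v) (hu : 1 < a u) :
    0 < (∏ i ∈ Finset.univ \ {u, v}, a i) * (a u - 1) * (a v + 1) ∧
    Real.log ((∏ i ∈ Finset.univ \ {u, v}, a i) * (a u - 1) * (a v + 1)) =
      ∑ i, Real.log (a i) + (Real.log (a v + 1) - Real.log (a v))
        - (Real.log (a u) - Real.log (a u - 1)) := by
  have hP : 0 < ∏ i ∈ Finset.univ \ {u, v}, a i := Finset.prod_pos fun i _ => ha i
  have hu' : 0 < a u - 1 := sub_pos.2 hu
  have hv' : 0 < a v + 1 := by linarith [ha v]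
  refine ⟨by positivity, ?_⟩
  rw [Real.log_mul (by positivity) hv'.ne', Real.log_mul hP.ne' hu'.ne',
    Real.log_prod fun i _ => (ha i).ne',
    ← Finset.sum_sdiff (Finset.subset_univ {u, v}) (f := fun i => Real.log (a i)),
    Finset.sum_pair huv]
  ring

/-- The values of binary bundles are integers. -/
theorem exists_nat_eq_sum_of_binary {ι : Type*} {f : ι → ℝ} (hf : ∀ j, f j = 0 ∨ f j = 1)
    (s : Finset ι) : ∃ k : ℕ, ∑ j ∈ s, f j = k := by
  refine ⟨∑ j ∈ s, if f j = 1 then 1 else 0, ?_⟩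
  push_cast
  refine Finset.sum_congr rfl fun j _ => ?_
  rcases hf j with h | h <;> simp [h]

/-- If `A` has smaller total log-value than `S`, some unit transfer along a path of the exchange
graph of `A` gains at least a `1 / m` fraction of the difference. -/
theorem exists_transfer_gain {n m : ℕ} (hn : 0 < n) (hm : 0 < m) {w : Fin n → Fin m → ℝ}
    (hbin : ∀ i j, w i j = 0 ∨ w i j = 1) {A S : Fin n → Finset (Fin m)}
    (hAdisj : ∀ k l : Fin n, k ≠ l → Disjoint (A k) (A l))
    (hAcov : ∀ j : Fin m, ∃ k : Fin n, j ∈ A k)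
    (hSdisj : ∀ k l : Fin n, k ≠ l → Disjoint (S k) (S l))
    (hScov : ∀ j : Fin m, ∃ k : Fin n, j ∈ S k)
    (hnw : ∀ i : Fin n, ∀ j ∈ A i, w i j = 1) {a s : Fin n → ℝ}
    (ha : ∀ i, a i = ∑ j ∈ A i, w i j) (hs : ∀ i, s i = ∑ j ∈ S i, w i j)
    (hapos : ∀ i, 0 < a i) (hspos : ∀ i, 0 < s i)
    (hD : 0 < ∑ i, Real.log (s i) - ∑ i, Real.log (a i)) :
    ∃ u v : Fin n, u ≠ v ∧
      Relation.ReflTransGen (fun x y : Fin n => ∃ j ∈ A x, w y j = 1) u v ∧ 2 ≤ a u ∧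
      (∑ i, Real.log (s i) - ∑ i, Real.log (a i)) / m ≤
        (Real.log (a v + 1) - Real.log (a v)) - (Real.log (a u) - Real.log (a u - 1)) := by
  classical
  by_contra! hcon
  set R := Relation.ReflTransGen (fun x y : Fin n => ∃ j ∈ A x, w y j = 1) with hR
  set c := (∑ i, Real.log (s i) - ∑ i, Real.log (a i)) / m with hc
  have hm' : (0 : ℝ) < m := by exact_mod_cast hm
  have hcpos : 0 < c := div_pos hD hm'
  set g : Fin n → ℝ := fun v => Real.log (a v + 1) - Real.log (a v) with hg
  have hgnn : ∀ v, 0 ≤ g v := fun v =>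
    sub_nonneg.2 (Real.log_le_log (hapos v) (by linarith))
  choose ka hka using fun i => exists_nat_eq_sum_of_binary (hbin i) (A i)
  choose ks hks using fun i => exists_nat_eq_sum_of_binary (hbin i) (S i)
  have ha' : ∀ i, a i = ka i := fun i => (ha i).trans (hka i)
  have hs' : ∀ i, s i = ks i := fun i => (hs i).trans (hks i)
  have ha1 : ∀ i, 1 ≤ a i := fun i => by
    have := hapos i
    rw [ha'] at this ⊢
    exact_mod_cast this
  have hs1 : ∀ i, 1 ≤ s i := fun i => by
    have := hspos i
    rw [hs'] at this ⊢
    exact_mod_cast this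
  have hne : (Finset.univ : Finset (Fin n)).Nonempty := ⟨⟨0, hn⟩, Finset.mem_univ _⟩
  -- the best marginal gain of a deficient agent reachable from `x`
  set t : Fin n → Fin n → ℝ := fun x v => if R x v ∧ a v < s v then g v else 0 with ht
  set p : Fin n → ℝ := fun x => Finset.univ.sup' hne (t x) with hp
  have htnn : ∀ x v, 0 ≤ t x v := fun x v => by
    simp only [ht]
    split_ifs
    · exact hgnn v
    · exact le_rfl
  have htp : ∀ x v, t x v ≤ p x := fun x v => Finset.le_sup' (t x) (Finset.mem_univ v)
  have hpnn : ∀ x, 0 ≤ p x := fun x => (htnn x x).trans (htp x x)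
  have hedge : ∀ x y, (∃ j ∈ A x, w y j = 1) → p y ≤ p x := by
    intro x y hxy
    refine Finset.sup'_le _ _ fun v _ => ?_
    by_cases h : R y v ∧ a v < s v
    · have h' : R x v ∧ a v < s v := ⟨Relation.ReflTransGen.head hxy h.1, h.2⟩
      have := htp x v
      simp only [ht, if_pos h, if_pos h'] at this ⊢
      exact this
    · simpa only [ht, if_neg h] using hpnn x
  have hflow := sum_value_mul_le_of_antitone_potential hbin hAdisj hAcov hSdisj hScov hnw
    hpnn hedge
  simp only [← ha, ← hs] at hflow
  have hterm : ∀ i, Real.log (s i) - Real.log (a i) ≤ s i * p i - a i * p i + c * (a i - 1) := by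
    intro i
    have hci : 0 ≤ c * (a i - 1) := mul_nonneg hcpos.le (sub_nonneg.2 (ha1 i))
    rcases lt_trichotomy (a i) (s i) with h | h | h
    · have hstep : a i + 1 ≤ s i := by
        rw [ha', hs'] at h ⊢
        exact_mod_cast h
      have hgp : g i ≤ p i := by
        have := htp i i
        simpa only [ht, if_pos (⟨Relation.ReflTransGen.refl, h⟩ : R i i ∧ a i < s i)] using this
      have h1 := log_sub_log_le_mul_succ (hapos i) hstep
      have h2 := mul_le_mul_of_nonneg_left hgp (sub_nonneg.2 h.le)
      simp only [hg] at h2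
      linarith
    · rw [h] at hci ⊢
      linarith
    · have hstep : s i + 1 ≤ a i := by
        rw [ha', hs'] at h ⊢
        exact_mod_cast h
      have h2a : 2 ≤ a i := by linarith [hs1 i]
      have hf : 0 ≤ Real.log (a i) - Real.log (a i - 1) :=
        sub_nonneg.2 (Real.log_le_log (by linarith) (by linarith))
      have hpf : p i ≤ Real.log (a i) - Real.log (a i - 1) + c := by
        refine Finset.sup'_le _ _ fun v _ => ?_
        by_cases hv : R i v ∧ a v < s v
        · have hiv : i ≠ v := by
            rintro rfl
            exact lt_asymm h hv.2
          have := hcon i v hiv hv.1 h2a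
          simp only [ht, if_pos hv, hg]
          linarith
        · simp only [ht, if_neg hv]
          linarith
      have h1 := log_sub_log_le_mul_pred (hspos i) hstep
      have h2 := mul_le_mul_of_nonneg_left hpf (sub_nonneg.2 h.le)
      have h3 : c * (a i - s i) ≤ c * (a i - 1) :=
        mul_le_mul_of_nonneg_left (by linarith [hs1 i]) hcpos.le
      linarith
  have hsum := Finset.sum_le_sum fun i (_ : i ∈ Finset.univ) => hterm i
  have htotal : ∑ i, a i = m := by
    have : ∀ i, a i = ∑ j ∈ A i, (1 : ℝ) := fun i =>
      (ha i).trans (Finset.sum_congr rfl fun j hj => hnw i j hj)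
    rw [Finset.sum_congr rfl fun i _ => this i, sum_sum_bundle hAdisj hAcov]
    simp
  rw [Finset.sum_sub_distrib, Finset.sum_add_distrib, Finset.sum_sub_distrib, ← Finset.mul_sum,
    Finset.sum_sub_distrib, htotal] at hsum
  have hcm : c * m = ∑ i, Real.log (s i) - ∑ i, Real.log (a i) := div_mul_cancel₀ _ hm'.ne'
  have hcn : 0 < c * n := mul_pos hcpos (by exact_mod_cast hn)
  simp only [Finset.sum_const, Finset.card_univ, Fintype.card_fin, nsmul_eq_mul, mul_one] at hsum
  linarith

/-- For binary additive valuations, a Nash optimal allocation `A*`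
with `NSW(A*) > 0`, and a non-wasteful allocation `A` with `0 < NSW(A) < NSW(A*)`,
there are agents `u ≠ v` with `v` reachable from `u` in the exchange graph `G(A)`
and `v_u(A_u) ≥ 2`, such that the Nash welfare `NSW'` obtained by moving one unit
of value from `u` to `v` satisfies
`ln NSW(A*) − ln NSW' ≤ (1 − 1/m)·(ln NSW(A*) − ln NSW(A))`. -/
theorem binary_main_lemma {n m : ℕ} (hn : 0 < n) (hm : 0 < m)
    (w : Fin n → Fin m → ℝ) (hbin : ∀ i j, w i j = 0 ∨ w i j = 1)
    (A Astar : Fin n → Finset (Fin m))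
    (hAdisj : ∀ k l : Fin n, k ≠ l → Disjoint (A k) (A l))
    (hAcov : ∀ j : Fin m, ∃ k : Fin n, j ∈ A k)
    (hSdisj : ∀ k l : Fin n, k ≠ l → Disjoint (Astar k) (Astar l))
    (hScov : ∀ j : Fin m, ∃ k : Fin n, j ∈ Astar k)
    (hnw : ∀ i : Fin n, ∀ j ∈ A i, w i j = 1)
    (hopt : ∀ B : Fin n → Finset (Fin m),
      (∀ k l : Fin n, k ≠ l → Disjoint (B k) (B l)) →
      (∀ j : Fin m, ∃ k : Fin n, j ∈ B k) →
      NSW w B ≤ NSW w Astar)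
    (hoptpos : 0 < NSW w Astar)
    (hpos : 0 < NSW w A) (hsub : NSW w A < NSW w Astar) :
    ∃ u v : Fin n, u ≠ v ∧
      Relation.ReflTransGen (fun a b : Fin n => ∃ j ∈ A a, w b j = 1) u v ∧
      2 ≤ ∑ j ∈ A u, w u j ∧
      Real.log (NSW w Astar) -
        Real.log (((∏ i ∈ Finset.univ \ {u, v}, ∑ j ∈ A i, w i j) *
            ((∑ j ∈ A u, w u j) - 1) * ((∑ j ∈ A v, w v j) + 1)) ^ ((n : ℝ)⁻¹)) ≤
        (1 - 1 / (m : ℝ)) * (Real.log (NSW w Astar) - Real.log (NSW w A)) := by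
  have hw : ∀ i j, 0 ≤ w i j := fun i j => by
    rcases hbin i j with h | h <;> simp [h]
  have hapos := value_pos_of_NSW_pos hn hw hpos
  have hlog := Real.log_lt_log hpos hsub
  have hn' : (0 : ℝ) < (n : ℝ)⁻¹ := inv_pos.2 (by exact_mod_cast hn)
  rw [log_NSW_eq hn hw hpos, log_NSW_eq hn hw hoptpos] at hlog ⊢
  obtain ⟨u, v, huv, hreach, hu, hgain⟩ := exists_transfer_gain hn hm hbin hAdisj hAcov hSdisj
    hScov hnw (fun _ => rfl) (fun _ => rfl) hapos (value_pos_of_NSW_pos hn hw hoptpos)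
    (sub_pos.2 (lt_of_mul_lt_mul_left hlog hn'.le))
  refine ⟨u, v, huv, hreach, hu, ?_⟩
  obtain ⟨hpos', hlog'⟩ := log_prod_transfer hapos huv (by linarith)
  rw [Real.log_rpow hpos', hlog']
  have := mul_le_mul_of_nonneg_left hgain hn'.le
  rw [div_eq_mul_one_div] at this
  linarith
end

section
/- Let there be n agents with binary additive valuations over m goods, let A* be a Nash optimal allocation with NSW(A*) > 0, and let A be a non-wasteful allocation with 0 < NSW(A) < NSW(A*). Then there exist agents u ≠ v such that v is reachable from u in the directed graph G(A) and (v_u(A_u) − 1)·(v_v(A_v) + 1) > v_u(A_u)·v_v(A_v); that is, every suboptimal non-wasteful allocation admits a chain of single-good swaps that strictly increases the Nash social welfare. -/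
open Finset

/-- The increment `log t - log (t - 1)` of the logarithm, extended to `t ≤ 1` so that it is
antitone on all natural numbers. -/
noncomputable def logStep (t : ℕ) : ℝ :=
  Real.log (1 + 1 / ((max t 2 : ℕ) - 1 : ℝ))

lemma logStep_nonneg (t : ℕ) : 0 ≤ logStep t := by
  have h : (2 : ℝ) ≤ (max t 2 : ℕ) := by exact_mod_cast le_max_right t 2
  have : 0 ≤ 1 / ((max t 2 : ℕ) - 1 : ℝ) := by
    apply div_nonneg <;> linarith
  exact Real.log_nonneg (by linarith)

lemma logStep_antitone : Antitone logStep := by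
  intro s t hst
  have hs : (2 : ℝ) ≤ (max s 2 : ℕ) := by exact_mod_cast le_max_right s 2
  have hle : ((max s 2 : ℕ) : ℝ) ≤ (max t 2 : ℕ) := by
    exact_mod_cast max_le_max_right 2 hst
  unfold logStep
  have hpos : 0 < 1 / ((max t 2 : ℕ) - 1 : ℝ) := by
    apply div_pos <;> linarith
  apply Real.log_le_log (by linarith)
  have : 1 / ((max t 2 : ℕ) - 1 : ℝ) ≤ 1 / ((max s 2 : ℕ) - 1 : ℝ) :=
    one_div_le_one_div_of_le (by linarith) (by linarith)
  linarith

lemma log_succ_eq {t : ℕ} (ht : 1 ≤ t) :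
    Real.log ((t + 1 : ℕ) : ℝ) = Real.log t + logStep (t + 1) := by
  have h0 : (0 : ℝ) < t := by exact_mod_cast ht
  have hmax : max (t + 1) 2 = t + 1 := by omega
  unfold logStep
  rw [hmax, ← Real.log_mul h0.ne' (by push_cast; simp; positivity)]
  congr 1
  push_cast
  rw [add_sub_cancel_right]
  field_simp

/-- Every slope between two consecutive logarithmic increments at `a` is a supergradient of the
logarithm at `a` on the positive integers. -/
lemma log_le_log_add_slope {a b : ℕ} {p : ℝ} (ha : 1 ≤ a) (hb : 1 ≤ b)
    (hlo : logStep (a + 1) ≤ p) (hhi : p ≤ logStep a) :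
    Real.log b ≤ Real.log a + p * ((b : ℝ) - a) := by
  rcases le_total a b with hab | hab
  · induction b, hab using Nat.le_induction with
    | base => simp
    | succ k hk ih =>
      have h1 := ih (ha.trans hk)
      have h2 : logStep (k + 1) ≤ logStep (a + 1) := logStep_antitone (by omega)
      rw [log_succ_eq (ha.trans hk)]
      push_cast
      linarith
  · clear hlo
    induction a, hab using Nat.le_induction with
    | base => simp
    | succ k hk ih =>
      have h1 := ih (hb.trans hk) (hhi.trans (logStep_antitone (by omega)))
      rw [log_succ_eq (hb.trans hk)]
      push_cast
      linarith

/-- A sum over agents and their goods is a sum over goods, evaluated at the owner. -/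
lemma sum_bundles_eq_sum_owner {n m : ℕ} {B : Fin n → Finset (Fin m)}
    (hdisj : ∀ k l : Fin n, k ≠ l → Disjoint (B k) (B l))
    {o : Fin m → Fin n} (ho : ∀ j, j ∈ B (o j)) (f : Fin n → Fin m → ℝ) :
    ∑ i, ∑ j ∈ B i, f i j = ∑ j, f (o j) j := by
  have hmem : ∀ i, B i = univ.filter (fun j => o j = i) := by
    intro i
    ext j
    simp only [mem_filter, mem_univ, true_and]
    refine ⟨fun hj => ?_, fun h => h ▸ ho j⟩
    by_contra hne
    exact Finset.disjoint_left.mp (hdisj _ _ hne) (ho j) hj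
  rw [← Finset.sum_fiberwise univ o (fun j => f (o j) j)]
  refine Finset.sum_congr rfl fun i _ => ?_
  rw [hmem i]
  refine Finset.sum_congr rfl fun j hj => ?_
  rw [(Finset.mem_filter.mp hj).2]

/-- If prices weakly decrease along the edges of the exchange graph of `A`, then no allocation is
worth more than `A` at these prices. -/
lemma sum_price_mul_value_le {n m : ℕ} {w : Fin n → Fin m → ℝ}
    (hbin : ∀ i j, w i j = 0 ∨ w i j = 1) {A B : Fin n → Finset (Fin m)}
    (hAdisj : ∀ k l : Fin n, k ≠ l → Disjoint (A k) (A l))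
    (hAcov : ∀ j : Fin m, ∃ k : Fin n, j ∈ A k)
    (hBdisj : ∀ k l : Fin n, k ≠ l → Disjoint (B k) (B l))
    (hBcov : ∀ j : Fin m, ∃ k : Fin n, j ∈ B k)
    (hnw : ∀ i : Fin n, ∀ j ∈ A i, w i j = 1) {p : Fin n → ℝ} (hp : ∀ i, 0 ≤ p i)
    (hmono : ∀ a b, (∃ j ∈ A a, w b j = 1) → p b ≤ p a) :
    ∑ i, p i * ∑ j ∈ B i, w i j ≤ ∑ i, p i * ∑ j ∈ A i, w i j := by
  choose oA hoA using hAcov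
  choose oB hoB using hBcov
  simp only [Finset.mul_sum]
  rw [sum_bundles_eq_sum_owner hAdisj hoA (fun i j => p i * w i j),
    sum_bundles_eq_sum_owner hBdisj hoB (fun i j => p i * w i j)]
  refine Finset.sum_le_sum fun j _ => ?_
  rw [hnw _ _ (hoA j), mul_one]
  rcases hbin (oB j) j with h | h
  · rw [h, mul_zero]
    exact hp _
  · rw [h, mul_one]
    exact hmono _ _ ⟨j, hoA j, h⟩

/-- Under binary valuations the value of a bundle is a natural number. -/
lemma exists_nat_eq_sum {m : ℕ} {f : Fin m → ℝ} (hf : ∀ j, f j = 0 ∨ f j = 1)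
    (S : Finset (Fin m)) : ∃ k : ℕ, ∑ j ∈ S, f j = k := by
  choose g hg using fun j => show ∃ k : ℕ, f j = k from
    (hf j).elim (fun h => ⟨0, by simpa using h⟩) (fun h => ⟨1, by simpa using h⟩)
  exact ⟨∑ j ∈ S, g j, by simp [hg]⟩

/-- Positive Nash social welfare means that every agent has nonzero value. -/
lemma value_ne_zero_of_NSW_pos {n m : ℕ} (hn : 0 < n) {w : Fin n → Fin m → ℝ}
    {A : Fin n → Finset (Fin m)} (h : 0 < NSW w A) (i : Fin n) :
    ∑ j ∈ A i, w i j ≠ 0 := by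
  intro h0
  have hprod : ∏ i : Fin n, ∑ j ∈ A i, w i j = 0 := Finset.prod_eq_zero (mem_univ i) h0
  have hne : ((n : ℝ)⁻¹) ≠ 0 := by positivity
  rw [NSW, hprod, Real.zero_rpow hne] at h
  exact lt_irrefl _ h

/-- For binary additive valuations, given a Nash optimal allocation
`A*` with `NSW(A*) > 0` and a non-wasteful allocation `A` with
`0 < NSW(A) < NSW(A*)`, there exist agents `u ≠ v` with `v` reachable from `u` in
the exchange graph `G(A)` such that
`(v_u(A_u) − 1)·(v_v(A_v) + 1) > v_u(A_u)·v_v(A_v)`: some chain of single-good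
swaps strictly increases the Nash social welfare. -/
theorem binary_improving_swap_chain {n m : ℕ} (hn : 0 < n)
    (w : Fin n → Fin m → ℝ) (hbin : ∀ i j, w i j = 0 ∨ w i j = 1)
    (A Astar : Fin n → Finset (Fin m))
    (hAdisj : ∀ k l : Fin n, k ≠ l → Disjoint (A k) (A l))
    (hAcov : ∀ j : Fin m, ∃ k : Fin n, j ∈ A k)
    (hSdisj : ∀ k l : Fin n, k ≠ l → Disjoint (Astar k) (Astar l))
    (hScov : ∀ j : Fin m, ∃ k : Fin n, j ∈ Astar k)
    (hnw : ∀ i : Fin n, ∀ j ∈ A i, w i j = 1)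
    (hopt : ∀ B : Fin n → Finset (Fin m),
      (∀ k l : Fin n, k ≠ l → Disjoint (B k) (B l)) →
      (∀ j : Fin m, ∃ k : Fin n, j ∈ B k) →
      NSW w B ≤ NSW w Astar)
    (hoptpos : 0 < NSW w Astar)
    (hpos : 0 < NSW w A) (hsub : NSW w A < NSW w Astar) :
    ∃ u v : Fin n, u ≠ v ∧
      Relation.ReflTransGen (fun a b : Fin n => ∃ j ∈ A a, w b j = 1) u v ∧
      (∑ j ∈ A u, w u j) * (∑ j ∈ A v, w v j) <
        ((∑ j ∈ A u, w u j) - 1) * ((∑ j ∈ A v, w v j) + 1) := by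
  classical
  by_contra! hcon
  choose a ha using fun i => exists_nat_eq_sum (hbin i) (A i)
  choose b hb using fun i => exists_nat_eq_sum (hbin i) (Astar i)
  have ha1 : ∀ i, 1 ≤ a i := fun i => Nat.one_le_iff_ne_zero.mpr fun h =>
    value_ne_zero_of_NSW_pos hn hpos i (by rw [ha, h, Nat.cast_zero])
  have hb1 : ∀ i, 1 ≤ b i := fun i => Nat.one_le_iff_ne_zero.mpr fun h =>
    value_ne_zero_of_NSW_pos hn hoptpos i (by rw [hb, h, Nat.cast_zero])
  set E : Fin n → Fin n → Prop := fun a b => ∃ j ∈ A a, w b j = 1 with hE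
  have hbal : ∀ u v, Relation.ReflTransGen E u v → a u ≤ a v + 1 := by
    intro u v huv
    rcases eq_or_ne u v with rfl | hne
    · omega
    · have h := hcon u v hne huv
      rw [ha, ha] at h
      have h2 : (a u : ℝ) ≤ a v + 1 := by linarith
      exact_mod_cast h2
  let M : Fin n → ℕ := fun i => (univ.filter fun u => Relation.ReflTransGen E u i).sup a
  have hMlo : ∀ i, a i ≤ M i := fun i =>
    Finset.le_sup (f := a) (mem_filter.mpr ⟨mem_univ i, .refl⟩)
  have hMhi : ∀ i, M i ≤ a i + 1 := fun i =>
    Finset.sup_le fun u hu => hbal u i (mem_filter.mp hu).2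
  have hMmono : ∀ c d, E c d → M c ≤ M d := fun c d hcd =>
    Finset.sup_mono fun u hu =>
      mem_filter.mpr ⟨mem_univ u, (mem_filter.mp hu).2.tail hcd⟩
  have hprice := sum_price_mul_value_le hbin hAdisj hAcov hSdisj hScov hnw
    (fun i => logStep_nonneg (M i)) (fun c d hcd => logStep_antitone (hMmono c d hcd))
  simp only [ha, hb] at hprice
  have hlog : ∑ i, Real.log (b i) ≤ ∑ i, Real.log (a i) := by
    have h : ∑ i, Real.log (b i) ≤
        ∑ i, (Real.log (a i) + logStep (M i) * ((b i : ℝ) - a i)) :=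
      Finset.sum_le_sum fun i _ => log_le_log_add_slope (ha1 i) (hb1 i)
        (logStep_antitone (hMhi i)) (logStep_antitone (hMlo i))
    simp only [mul_sub, Finset.sum_add_distrib, Finset.sum_sub_distrib] at h
    linarith
  have hapos : ∀ i, (0 : ℝ) < a i := fun i => by exact_mod_cast ha1 i
  have hbpos : ∀ i, (0 : ℝ) < b i := fun i => by exact_mod_cast hb1 i
  rw [← Real.log_prod fun i _ => (hbpos i).ne', ← Real.log_prod fun i _ => (hapos i).ne',
    Real.log_le_log_iff (Finset.prod_pos fun i _ => hbpos i)
      (Finset.prod_pos fun i _ => hapos i)] at hlog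
  refine hsub.not_ge ?_
  simp only [NSW, ha, hb]
  exact Real.rpow_le_rpow (Finset.prod_nonneg fun i _ => (hbpos i).le) hlog (by positivity)
end

section
/- Let there be n agents with binary additive valuations over m goods, and let A be a non-wasteful allocation with NSW(A) > 0. Suppose that for every pair of agents u ≠ v such that v is reachable from u in the directed graph G(A), one has (v_u(A_u) − 1)·(v_v(A_v) + 1) ≤ v_u(A_u)·v_v(A_v). Then A is Nash optimal: NSW(A) ≥ NSW(B) for every allocation B. In other words, for binary additive valuations, any allocation that is locally optimal with respect to chains of single-good swaps is globally Nash optimal. -/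
open Finset

/-- The increment `log (k + 1) - log k` is antitone in `k`. -/
theorem log_succ_sub_log_antitone {k l : ℕ} (hk : 1 ≤ k) (hkl : k ≤ l) :
    Real.log (l + 1) - Real.log l ≤ Real.log (k + 1) - Real.log k := by
  have hk' : (0 : ℝ) < k := by exact_mod_cast hk
  have hl' : (k : ℝ) ≤ l := by exact_mod_cast hkl
  have hl0 : (0 : ℝ) < l := hk'.trans_le hl'
  rw [← Real.log_div (by positivity) (by positivity),
    ← Real.log_div (by positivity) (by positivity)]
  apply Real.log_le_log (by positivity)
  rw [div_le_div_iff₀ hl0 hk']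
  nlinarith

/-- The chord of `log` through `s` and `s + 1` lies above `log` at the positive integers. -/
theorem log_le_chord {s b : ℕ} (hs : 1 ≤ s) (hb : 1 ≤ b) :
    Real.log b ≤ Real.log s + ((b : ℝ) - s) * (Real.log (s + 1) - Real.log s) := by
  rcases le_total s b with h | h
  · induction b, h using Nat.le_induction with
    | base => simp
    | succ b hsb ih =>
      have := log_succ_sub_log_antitone hs hsb
      have := ih (hs.trans hsb)
      push_cast
      linarith
  · induction s, h using Nat.le_induction with
    | base => simp
    | succ s hbs ih =>
      have hs' := hb.trans hbs
      have h1 := ih hs'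
      have h2 := log_succ_sub_log_antitone hs' (Nat.le_succ s)
      have h3 : (b : ℝ) ≤ s := by exact_mod_cast hbs
      push_cast at h2 ⊢
      nlinarith

/-- Integer tangent inequality for `log` at `a`, for either of the two unit slopes adjacent to
`a`. -/
theorem log_le_add_mul_of_adjacent {s a b : ℕ} (hs : 1 ≤ s) (hb : 1 ≤ b)
    (ha : a = s ∨ a = s + 1) :
    Real.log b ≤ Real.log a + ((b : ℝ) - a) * (Real.log (s + 1) - Real.log s) := by
  have h := log_le_chord hs hb
  rcases ha with rfl | rfl
  · exact h
  · push_cast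
    linarith

/-- If the price of a good's new owner never exceeds the price of its old owner, the total price
paid does not increase. -/
theorem sum_card_mul_le_sum_card_mul {ι κ : Type*} [Fintype ι] [Fintype κ] [DecidableEq κ]
    {A C : ι → Finset κ} {p : ι → ℝ} (hp : ∀ i, 0 ≤ p i)
    (hA : ∀ k l, k ≠ l → Disjoint (A k) (A l)) (hcov : ∀ j, ∃ k, j ∈ A k)
    (hC : ∀ k l, k ≠ l → Disjoint (C k) (C l))
    (hAC : ∀ k l j, j ∈ A k → j ∈ C l → p l ≤ p k) :
    ∑ i, ((C i).card : ℝ) * p i ≤ ∑ i, ((A i).card : ℝ) * p i := by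
  choose o ho using hcov
  have ho_eq : ∀ i, ∀ j ∈ A i, o j = i := by
    intro i j hj
    by_contra hne
    exact Finset.disjoint_left.mp (hA _ _ hne) (ho j) hj
  calc ∑ i, ((C i).card : ℝ) * p i
      = ∑ i, ∑ j ∈ C i, p i := by simp
    _ ≤ ∑ i, ∑ j ∈ C i, p (o j) :=
        Finset.sum_le_sum fun i _ => Finset.sum_le_sum fun j hj => hAC _ _ j (ho j) hj
    _ = ∑ j ∈ Finset.univ.biUnion C, p (o j) :=
        (Finset.sum_biUnion fun k _ l _ hkl => hC k l hkl).symm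
    _ ≤ ∑ j ∈ Finset.univ.biUnion A, p (o j) := by
        refine Finset.sum_le_sum_of_subset_of_nonneg (fun j _ => ?_) fun j _ _ => hp _
        exact Finset.mem_biUnion.mpr ⟨o j, Finset.mem_univ _, ho j⟩
    _ = ∑ i, ∑ j ∈ A i, p (o j) := Finset.sum_biUnion fun k _ l _ hkl => hA k l hkl
    _ = ∑ i, ∑ j ∈ A i, p i :=
        Finset.sum_congr rfl fun i _ => Finset.sum_congr rfl fun j hj => by rw [ho_eq i j hj]
    _ = ∑ i, ((A i).card : ℝ) * p i := by simp

/-- If `a` drops by at most one along paths of `R`, each vertex can be assigned a level adjacent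
to its value of `a`, monotonically along the edges of `R`. -/
theorem exists_monotone_level {ι : Type*} [Fintype ι] (R : ι → ι → Prop) {a : ι → ℕ}
    (ha : ∀ i, 1 ≤ a i) (hR : ∀ u v, Relation.ReflTransGen R u v → a u ≤ a v + 1) :
    ∃ s : ι → ℕ, (∀ i, 1 ≤ s i) ∧ (∀ i, a i = s i ∨ a i = s i + 1) ∧
      ∀ u v, R u v → s u ≤ s v := by
  classical
  let r : ι → ℕ := fun i => (Finset.univ.filter fun u => Relation.ReflTransGen R u i).sup a
  have hle : ∀ i, a i ≤ r i := fun i =>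
    Finset.le_sup (f := a) (by simp [Relation.ReflTransGen.refl])
  have hge : ∀ i, r i ≤ a i + 1 := fun i =>
    Finset.sup_le fun u hu => hR u i (Finset.mem_filter.mp hu).2
  refine ⟨fun i => max (r i - 1) 1, fun i => le_max_right _ _, fun i => ?_, fun u v huv => ?_⟩
  · have := hle i
    have := hge i
    have := ha i
    dsimp only
    omega
  · have : r u ≤ r v := Finset.sup_mono fun x hx => by
      simp only [Finset.mem_filter, Finset.mem_univ, true_and] at hx ⊢
      exact hx.tail huv
    dsimp only
    omega

/-- For binary additive valuations, a non-wasteful allocation `A`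
with `NSW(A) > 0` that is locally optimal with respect to chains of single-good
swaps (for every `u ≠ v` with `v` reachable from `u` in `G(A)`,
`(v_u(A_u) − 1)·(v_v(A_v) + 1) ≤ v_u(A_u)·v_v(A_v)`) is globally Nash optimal. -/
theorem binary_local_opt_is_global {n m : ℕ} (hn : 0 < n)
    (w : Fin n → Fin m → ℝ) (hbin : ∀ i j, w i j = 0 ∨ w i j = 1)
    (A : Fin n → Finset (Fin m))
    (hAdisj : ∀ k l : Fin n, k ≠ l → Disjoint (A k) (A l))
    (hAcov : ∀ j : Fin m, ∃ k : Fin n, j ∈ A k)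
    (hnw : ∀ i : Fin n, ∀ j ∈ A i, w i j = 1)
    (hpos : 0 < NSW w A)
    (hloc : ∀ u v : Fin n, u ≠ v →
      Relation.ReflTransGen (fun a b : Fin n => ∃ j ∈ A a, w b j = 1) u v →
      ((∑ j ∈ A u, w u j) - 1) * ((∑ j ∈ A v, w v j) + 1) ≤
        (∑ j ∈ A u, w u j) * (∑ j ∈ A v, w v j)) :
    ∀ B : Fin n → Finset (Fin m),
      (∀ k l : Fin n, k ≠ l → Disjoint (B k) (B l)) →
      (∀ j : Fin m, ∃ k : Fin n, j ∈ B k) →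
      NSW w B ≤ NSW w A := by
  intro B hBdisj _
  have hsumA : ∀ i, ∑ j ∈ A i, w i j = ((A i).card : ℝ) := fun i => by
    rw [Finset.sum_congr rfl (hnw i)]
    simp
  let C : Fin n → Finset (Fin m) := fun i => (B i).filter fun j => w i j = 1
  have hsumB : ∀ i, ∑ j ∈ B i, w i j = ((C i).card : ℝ) := fun i => by
    rw [Finset.card_filter]
    push_cast
    refine Finset.sum_congr rfl fun j _ => ?_
    rcases hbin i j with h | h <;> simp [h]
  simp only [NSW, hsumA, hsumB] at hpos hloc ⊢
  have hA1 : ∀ i, 1 ≤ (A i).card := by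
    intro i
    by_contra hi
    have hz : ((A i).card : ℝ) = 0 := by exact_mod_cast (by omega : (A i).card = 0)
    rw [Finset.prod_eq_zero (Finset.mem_univ i) hz,
      Real.zero_rpow (inv_ne_zero (Nat.cast_ne_zero.mpr hn.ne'))] at hpos
    exact lt_irrefl _ hpos
  refine Real.rpow_le_rpow (Finset.prod_nonneg fun i _ => Nat.cast_nonneg _) ?_
    (inv_nonneg.mpr (Nat.cast_nonneg n))
  by_cases hC1 : ∀ i, 1 ≤ (C i).card
  swap
  · push Not at hC1
    obtain ⟨i, hi⟩ := hC1
    have hz : ((C i).card : ℝ) = 0 := by exact_mod_cast (by omega : (C i).card = 0)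
    rw [Finset.prod_eq_zero (Finset.mem_univ i) hz]
    exact Finset.prod_nonneg fun i _ => Nat.cast_nonneg _
  have hR : ∀ u v, Relation.ReflTransGen (fun a b : Fin n => ∃ j ∈ A a, w b j = 1) u v →
      (A u).card ≤ (A v).card + 1 := by
    intro u v huv
    rcases eq_or_ne u v with rfl | hne
    · omega
    · have := hloc u v hne huv
      have h : ((A u).card : ℝ) ≤ (A v).card + 1 := by linarith
      exact_mod_cast h
  obtain ⟨s, hs1, hsA, hsmono⟩ := exists_monotone_level _ hA1 hR
  have hA0 : ∀ i, (0 : ℝ) < (A i).card := fun i => by exact_mod_cast hA1 i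
  have hC0 : ∀ i, (0 : ℝ) < (C i).card := fun i => by exact_mod_cast hC1 i
  have hprice := sum_card_mul_le_sum_card_mul (A := A) (C := C)
    (p := fun i => Real.log (s i + 1) - Real.log (s i))
    (fun i => sub_nonneg.mpr (Real.log_le_log (by exact_mod_cast hs1 i) (by linarith)))
    hAdisj hAcov
    (fun k l hkl => Finset.disjoint_filter_filter (hBdisj k l hkl))
    (fun k l j hjk hjl => log_succ_sub_log_antitone (hs1 k)
      (hsmono k l ⟨j, hjk, (Finset.mem_filter.mp hjl).2⟩))
  rw [← Real.log_le_log_iff (Finset.prod_pos fun i _ => hC0 i)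
    (Finset.prod_pos fun i _ => hA0 i),
    Real.log_prod (fun i _ => (hC0 i).ne'), Real.log_prod (fun i _ => (hA0 i).ne')]
  have htangent := Finset.sum_le_sum fun i (_ : i ∈ Finset.univ) =>
    log_le_add_mul_of_adjacent (hs1 i) (hC1 i) (hsA i)
  simp only [Finset.sum_add_distrib, sub_mul, Finset.sum_sub_distrib] at htangent hprice
  linarith
end

section
/- Let there be n agents with binary additive valuations over m goods, and let A, A* be non-wasteful allocations with NSW(A*) maximal and NSW(A) > 0. Define the excess set E = {u : |A_u| > |A*_u|} and the deficit set D = {v : |A_v| < |A*_v|}. If NSW(A) < NSW(A*), then both E and D are nonempty, and there exists an agent u ∈ E and an agent v ∈ D such that v is reachable from u in the directed graph G(A). -/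
open Finset

/-- For non-wasteful allocations under binary valuations, the Nash social welfare depends only
on the bundle sizes. -/
lemma NSW_eq_prod_card {n m : ℕ} (w : Fin n → Fin m → ℝ) (A : Fin n → Finset (Fin m))
    (hA : ∀ i, ∀ j ∈ A i, w i j = 1) :
    NSW w A = (∏ i, ((A i).card : ℝ)) ^ ((n : ℝ)⁻¹) := by
  unfold NSW
  congr 1
  refine Finset.prod_congr rfl fun i _ => ?_
  simp [Finset.sum_congr rfl (hA i)]

/-- If `B` covers, within `R`, every element that the disjoint family `A` places in `R`,
then `B` gives `R` at least as many elements as `A`. -/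
lemma sum_card_le_sum_card_of_forall_mem {ι α : Type*} [DecidableEq α] (R : Finset ι)
    (A B : ι → Finset α) (hA : ∀ k l, k ≠ l → Disjoint (A k) (A l))
    (h : ∀ k ∈ R, ∀ j ∈ A k, ∃ l ∈ R, j ∈ B l) :
    ∑ k ∈ R, (A k).card ≤ ∑ k ∈ R, (B k).card := by
  rw [← Finset.card_biUnion fun k _ l _ hkl => hA k l hkl]
  refine (Finset.card_le_card fun j hj => ?_).trans Finset.card_biUnion_le
  obtain ⟨k, hk, hj⟩ := Finset.mem_biUnion.mp hj
  exact Finset.mem_biUnion.mpr (h k hk j hj)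

/-- For binary additive valuations, let `A, A*` be non-wasteful
allocations with `A*` Nash optimal and `NSW(A) > 0`.  If `NSW(A) < NSW(A*)`, then
the excess set `E = {u : |A_u| > |A*_u|}` and the deficit set
`D = {v : |A_v| < |A*_v|}` are both nonempty, and some agent of `D` is reachable
in the exchange graph `G(A)` from some agent of `E`. -/
theorem excess_reaches_deficit {n m : ℕ} (hn : 0 < n)
    (w : Fin n → Fin m → ℝ) (hbin : ∀ i j, w i j = 0 ∨ w i j = 1)
    (A Astar : Fin n → Finset (Fin m))
    (hAdisj : ∀ k l : Fin n, k ≠ l → Disjoint (A k) (A l))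
    (hAcov : ∀ j : Fin m, ∃ k : Fin n, j ∈ A k)
    (hSdisj : ∀ k l : Fin n, k ≠ l → Disjoint (Astar k) (Astar l))
    (hScov : ∀ j : Fin m, ∃ k : Fin n, j ∈ Astar k)
    (hAnw : ∀ i : Fin n, ∀ j ∈ A i, w i j = 1)
    (hSnw : ∀ i : Fin n, ∀ j ∈ Astar i, w i j = 1)
    (hopt : ∀ B : Fin n → Finset (Fin m),
      (∀ k l : Fin n, k ≠ l → Disjoint (B k) (B l)) →
      (∀ j : Fin m, ∃ k : Fin n, j ∈ B k) →
      NSW w B ≤ NSW w Astar)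
    (hpos : 0 < NSW w A)
    (hsub : NSW w A < NSW w Astar) :
    (Finset.univ.filter fun u : Fin n => (Astar u).card < (A u).card).Nonempty ∧
    (Finset.univ.filter fun v : Fin n => (A v).card < (Astar v).card).Nonempty ∧
    ∃ u ∈ Finset.univ.filter fun u : Fin n => (Astar u).card < (A u).card,
      ∃ v ∈ Finset.univ.filter fun v : Fin n => (A v).card < (Astar v).card,
        Relation.ReflTransGen (fun a b : Fin n => ∃ j ∈ A a, w b j = 1) u v := by
  classical
  obtain ⟨u, hu⟩ : ∃ u, (Astar u).card < (A u).card := by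
    by_contra! hle
    have hsum : ∑ k, (A k).card = ∑ k, (Astar k).card :=
      (Finset.sum_le_sum fun k _ => hle k).antisymm <|
        sum_card_le_sum_card_of_forall_mem _ _ _ hSdisj fun _ _ j _ => by simpa using hAcov j
    have heq := (Finset.sum_eq_sum_iff_of_le fun k _ => hle k).mp hsum
    refine hsub.ne ?_
    rw [NSW_eq_prod_card w A hAnw, NSW_eq_prod_card w Astar hSnw,
      Finset.prod_congr rfl fun k hk => congrArg Nat.cast (heq k hk)]
  obtain ⟨v, hv, huv⟩ : ∃ v, (A v).card < (Astar v).card ∧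
      Relation.ReflTransGen (fun a b : Fin n => ∃ j ∈ A a, w b j = 1) u v := by
    by_contra! hno
    set R := Finset.univ.filter
      (Relation.ReflTransGen (fun a b : Fin n => ∃ j ∈ A a, w b j = 1) u) with hR
    have hle : ∑ k ∈ R, (A k).card ≤ ∑ k ∈ R, (Astar k).card := by
      refine sum_card_le_sum_card_of_forall_mem R A Astar hAdisj fun k hk j hj => ?_
      obtain ⟨l, hl⟩ := hScov j
      refine ⟨l, ?_, hl⟩
      simp only [hR, Finset.mem_filter, Finset.mem_univ, true_and] at hk ⊢
      exact hk.tail ⟨j, hj, hSnw l j hl⟩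
    refine hle.not_gt (Finset.sum_lt_sum (fun k hk => ?_) ⟨u, ?_, hu⟩)
    · by_contra! hlt
      exact hno k hlt (Finset.mem_filter.mp hk).2
    · exact Finset.mem_filter.mpr ⟨Finset.mem_univ u, .refl⟩
  simp only [Finset.Nonempty, Finset.mem_filter, Finset.mem_univ, true_and]
  exact ⟨⟨u, hu⟩, ⟨v, hv⟩, u, hu, v, hv, huv⟩
end
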